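/- arXiv:1303.2560 — 6 statements merged into one kernel-verified Lean document; each statement's English description precedes it below -/
import Mathlib

section
/- Let k be a field, d ≥ 1, and p, q ≥ d natural numbers. Let f₁ : Mat_{p×d}(k) → k be a function satisfying the relative invariance f₁(m·h) = (det h)^p · f₁(m) for every m ∈ Mat_{p×d}(k) and every invertible h ∈ Mat_{d×d}(k). Let f₂ : Mat_{q×d}(k) → k be a function such that whenever f₂(m₂') ≠ 0, the d×d block D(m₂') of m₂' formed by its last d rows is invertible. For an (p+q)×d matrix m write m^{top} for its first p rows and m^{bot} for its last q rows, and set f(m) := f₁(m^{top}) · f₂(m^{bot}). Then the map Φ(m₁', m₂') := the (p+q)×d matrix with top block m₁'·D(m₂') and bottom block m₂' is a bijection from {(m₁', m₂') : f₁(m₁') ≠ 0 and f₂(m₂') ≠ 0} onto {m ∈ Mat_{(p+q)×d}(k) : f(m) ≠ 0}, with inverse m ↦ (m^{top}·D(m^{bot})^{-1}, m^{bot}). -/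
open Matrix

theorem Matrix.fromRows_submatrix_inl {m₁ m₂ n R : Type*} (A : Matrix m₁ n R)
    (B : Matrix m₂ n R) : (fromRows A B).submatrix Sum.inl id = A :=
  rfl

theorem Matrix.fromRows_submatrix_inr {m₁ m₂ n R : Type*} (A : Matrix m₁ n R)
    (B : Matrix m₂ n R) : (fromRows A B).submatrix Sum.inr id = B :=
  rfl

theorem Matrix.fromRows_submatrix_inl_inr {m₁ m₂ n R : Type*} (M : Matrix (m₁ ⊕ m₂) n R) :
    fromRows (M.submatrix Sum.inl id) (M.submatrix Sum.inr id) = M := by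
  ext (i | i) j <;> rfl

/-- Let `k` be a field, `d ≥ 1`, `p, q ≥ d`.  Let
`f₁ : Mat_{p×d}(k) → k` satisfy `f₁(m·h) = (det h)^p · f₁(m)` for invertible `h`, and let
`f₂ : Mat_{q×d}(k) → k` be such that `f₂(m₂') ≠ 0` implies the `d×d` block `D(m₂')` of
`m₂'` formed by its last `d` rows is invertible.  Writing an `(p+q)×d` matrix as its first
`p` rows and last `q` rows, and setting `f(m) = f₁(m^top)·f₂(m^bot)`, the map
`Φ(m₁', m₂') = [m₁'·D(m₂'); m₂']` is a bijection from
`{(m₁', m₂') : f₁(m₁') ≠ 0 ∧ f₂(m₂') ≠ 0}` onto `{m : f(m) ≠ 0}`, with inverse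
`m ↦ (m^top·D(m^bot)⁻¹, m^bot)`. -/
theorem stiefel_bijection_one_step
    {k : Type*} [Field k] {d p q : ℕ}
    (hd : 1 ≤ d) (hp : d ≤ p) (hq : d ≤ q)
    (f₁ : Matrix (Fin p) (Fin d) k → k)
    (hf₁ : ∀ (m : Matrix (Fin p) (Fin d) k) (h : Matrix (Fin d) (Fin d) k),
      IsUnit h → f₁ (m * h) = h.det ^ p * f₁ m)
    (f₂ : Matrix (Fin q) (Fin d) k → k)
    (D : Matrix (Fin q) (Fin d) k → Matrix (Fin d) (Fin d) k)
    (hD : ∀ (m : Matrix (Fin q) (Fin d) k) (i j : Fin d),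
      D m i j = m ⟨q - d + (i : ℕ), by have := i.isLt; omega⟩ j)
    (hf₂ : ∀ m, f₂ m ≠ 0 → IsUnit (D m)) :
    Set.BijOn
      (fun mm : Matrix (Fin p) (Fin d) k × Matrix (Fin q) (Fin d) k =>
        fromRows (mm.1 * D mm.2) mm.2)
      {mm | f₁ mm.1 ≠ 0 ∧ f₂ mm.2 ≠ 0}
      {m : Matrix (Fin p ⊕ Fin q) (Fin d) k |
        f₁ (m.submatrix Sum.inl id) * f₂ (m.submatrix Sum.inr id) ≠ 0} ∧
    Set.InvOn
      (fun m : Matrix (Fin p ⊕ Fin q) (Fin d) k =>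
        (m.submatrix Sum.inl id * (D (m.submatrix Sum.inr id))⁻¹, m.submatrix Sum.inr id))
      (fun mm : Matrix (Fin p) (Fin d) k × Matrix (Fin q) (Fin d) k =>
        fromRows (mm.1 * D mm.2) mm.2)
      {mm | f₁ mm.1 ≠ 0 ∧ f₂ mm.2 ≠ 0}
      {m : Matrix (Fin p ⊕ Fin q) (Fin d) k |
        f₁ (m.submatrix Sum.inl id) * f₂ (m.submatrix Sum.inr id) ≠ 0} := by
  have hf₁_ne (m : Matrix (Fin p) (Fin d) k) (h : Matrix (Fin d) (Fin d) k) (hh : IsUnit h)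
      (hm : f₁ m ≠ 0) : f₁ (m * h) ≠ 0 := by
    rw [hf₁ m h hh]
    exact mul_ne_zero (pow_ne_zero _ ((isUnit_iff_isUnit_det h).1 hh).ne_zero) hm
  refine (and_iff_right_of_imp fun hinv => hinv.bijOn ?mapsTo ?mapsTo_inv).2 ⟨?left, ?right⟩
  case mapsTo =>
    rintro ⟨a, b⟩ ⟨ha, hb⟩
    exact mul_ne_zero (hf₁_ne a _ (hf₂ b hb) ha) hb
  case mapsTo_inv =>
    intro m hm
    have hb := right_ne_zero_of_mul hm
    exact ⟨hf₁_ne _ _ (isUnit_nonsing_inv_iff.2 (hf₂ _ hb)) (left_ne_zero_of_mul hm), hb⟩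
  case left =>
    rintro ⟨a, b⟩ ⟨-, hb⟩
    have hu := (isUnit_iff_isUnit_det _).1 (hf₂ b hb)
    simp only [fromRows_submatrix_inl, fromRows_submatrix_inr,
      mul_nonsing_inv_cancel_right _ _ hu]
  case right =>
    intro m hm
    have hu := (isUnit_iff_isUnit_det _).1 (hf₂ _ (right_ne_zero_of_mul hm))
    simp only [nonsing_inv_mul_cancel_right _ _ hu, fromRows_submatrix_inl_inr]
end

section
/- Let k be a field, d ≥ 1, and p, q ≥ d with n = p + q. Let f₁ : Mat_{p×d}(k) → k satisfy f₁(m·h) = (det h)^p·f₁(m) for all invertible h and be such that f₁(m) ≠ 0 implies the block of m formed by its first d rows is invertible; let f₂ : Mat_{q×d}(k) → k satisfy f₂(m·h) = (det h)^q·f₂(m) for all invertible h and be such that f₂(m) ≠ 0 implies the block D(m) of m formed by its last d rows is invertible. For m ∈ Mat_{n×d}(k) set f(m) := f₁(m^{top})·f₂(m^{bot}), where m^{top} is the first p rows and m^{bot} the last q rows. Then there is a bijection between the orbit space of the right GL_d(k)-multiplication action on {m : f(m) ≠ 0} and the product (orbit space of {m₁' : f₁(m₁') ≠ 0} under right GL_d(k)-multiplication)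 × (orbit space of {m₂' : f₂(m₂') ≠ 0} under right GL_d(k)-multiplication) × GL_d(k). -/
open Matrix

/-- Suppose that `s` and `t` are equivariant for right multiplication by invertible matrices and
take invertible values where `f₁`, respectively `f₂`, does not vanish. Then an orbit of matrices
with `f₁ a * f₂ b ≠ 0`, where `a` and `b` are the top and bottom blocks, is determined by the
orbits of `a` and `b` and the invariant `t b * (s a)⁻¹`. -/
noncomputable def orbitProdEquiv {R ι κ n : Type*} [Ring R] [NoZeroDivisors R] [Fintype n] [DecidableEq n]
    (f₁ : Matrix ι n R → R) (f₂ : Matrix κ n R → R)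
    (hf₁ : ∀ m (h : Matrix n n R), IsUnit h → f₁ m ≠ 0 → f₁ (m * h) ≠ 0)
    (hf₂ : ∀ m (h : Matrix n n R), IsUnit h → f₂ m ≠ 0 → f₂ (m * h) ≠ 0)
    (s : Matrix ι n R → Matrix n n R) (t : Matrix κ n R → Matrix n n R)
    (hs : ∀ m (h : Matrix n n R), s (m * h) = s m * h) (ht : ∀ m (h : Matrix n n R), t (m * h) = t m * h)
    (hs_unit : ∀ m, f₁ m ≠ 0 → IsUnit (s m)) (ht_unit : ∀ m, f₂ m ≠ 0 → IsUnit (t m)) :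
    Quot (fun a b : {m : Matrix (ι ⊕ κ) n R //
          f₁ (m.submatrix Sum.inl id) * f₂ (m.submatrix Sum.inr id) ≠ 0} =>
        ∃ h : Matrix n n R, IsUnit h ∧ b.1 = a.1 * h) ≃
      Quot (fun a b : {m : Matrix ι n R // f₁ m ≠ 0} =>
        ∃ h : Matrix n n R, IsUnit h ∧ b.1 = a.1 * h) ×
      Quot (fun a b : {m : Matrix κ n R // f₂ m ≠ 0} =>
        ∃ h : Matrix n n R, IsUnit h ∧ b.1 = a.1 * h) ×
      (Matrix n n R)ˣ where
  toFun := Quot.lift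
    (fun m =>
      (Quot.mk _ ⟨m.1.submatrix Sum.inl id, left_ne_zero_of_mul m.2⟩,
        Quot.mk _ ⟨m.1.submatrix Sum.inr id, right_ne_zero_of_mul m.2⟩,
        (ht_unit _ (right_ne_zero_of_mul m.2)).unit *
          (hs_unit _ (left_ne_zero_of_mul m.2)).unit⁻¹))
    (by
      rintro ⟨a, ha⟩ ⟨_, hb⟩ ⟨h, hh, rfl⟩
      refine Prod.ext (Quot.sound ⟨h, hh, rfl⟩) (Prod.ext (Quot.sound ⟨h, hh, rfl⟩) ?_)
      have h₁ : (hs_unit _ (left_ne_zero_of_mul hb)).unit =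
          (hs_unit _ (left_ne_zero_of_mul ha)).unit * hh.unit :=
        Units.ext (hs (a.submatrix Sum.inl id) h)
      have h₂ : (ht_unit _ (right_ne_zero_of_mul hb)).unit =
          (ht_unit _ (right_ne_zero_of_mul ha)).unit * hh.unit :=
        Units.ext (ht (a.submatrix Sum.inr id) h)
      simp only [h₁, h₂]
      group)
  invFun x := Quot.liftOn₂ x.1 x.2.1
    (fun a b => Quot.mk _
      ⟨Matrix.fromRows (a.1 * ((hs_unit _ a.2).unit⁻¹ : (Matrix n n R)ˣ).1)
        (b.1 * ((ht_unit _ b.2).unit⁻¹ * x.2.2 : (Matrix n n R)ˣ).1),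
        mul_ne_zero (hf₁ _ _ (Units.isUnit _) a.2) (hf₂ _ _ (Units.isUnit _) b.2)⟩)
    (by
      rintro a ⟨b, hb⟩ ⟨_, hc⟩ ⟨h, hh, rfl⟩
      have h₂ : (ht_unit _ hc).unit = (ht_unit _ hb).unit * hh.unit := Units.ext (ht b h)
      have key : b * h * ((ht_unit _ hc).unit⁻¹ * x.2.2 : (Matrix n n R)ˣ).1 =
          b * ((ht_unit _ hb).unit⁻¹ * x.2.2 : (Matrix n n R)ˣ).1 := by
        rw [h₂, Matrix.mul_assoc]
        congr 1
        change (hh.unit * _ : (Matrix n n R)ˣ).1 = _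
        congr 1
        group
      simp only [key])
    (by
      rintro ⟨a, ha⟩ ⟨_, hc⟩ b ⟨h, hh, rfl⟩
      have h₁ : (hs_unit _ hc).unit = (hs_unit _ ha).unit * hh.unit := Units.ext (hs a h)
      have key : a * h * ((hs_unit _ hc).unit⁻¹ : (Matrix n n R)ˣ).1 =
          a * ((hs_unit _ ha).unit⁻¹ : (Matrix n n R)ˣ).1 := by
        rw [h₁, Matrix.mul_assoc]
        congr 1
        change (hh.unit * _ : (Matrix n n R)ˣ).1 = _
        congr 1
        group
      simp only [key])
  left_inv := by
    rintro ⟨m, hm⟩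
    refine (Quot.sound ⟨((hs_unit _ (left_ne_zero_of_mul hm)).unit⁻¹ : (Matrix n n R)ˣ).1,
      Units.isUnit _, ?_⟩).symm
    ext (i | i) j
    · rfl
    · simp only [inv_mul_cancel_left]
      rfl
  right_inv := by
    rintro ⟨⟨a, ha⟩, ⟨b, hb⟩, g⟩
    refine Prod.ext (Quot.sound ⟨_, Units.isUnit _, rfl⟩).symm
      (Prod.ext (Quot.sound ⟨_, Units.isUnit _, rfl⟩).symm ?_)
    have h₁ (h : IsUnit (s (a * ((hs_unit _ ha).unit⁻¹ : (Matrix n n R)ˣ).1))) : h.unit = 1 :=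
      Units.ext ((hs _ _).trans (hs_unit _ ha).mul_val_inv)
    have h₂ (h : IsUnit (t (b * ((ht_unit _ hb).unit⁻¹ * g : (Matrix n n R)ˣ).1))) :
        h.unit = g :=
      Units.ext ((ht _ _).trans
        (congrArg Units.val (mul_inv_cancel_left (ht_unit _ hb).unit g)))
    exact (congrArg₂ (fun x y => x * y⁻¹) (h₂ _) (h₁ _)).trans (by simp)

/-- With `f₁`, `f₂` relatively invariant of weights `p`, `q` for the
right `GL_d(k)`-action, `f₁` supported where the top `d×d` block is invertible and `f₂`
supported where the bottom `d×d` block `D` is invertible, and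
`f(m) := f₁(m^top)·f₂(m^bot)` on `(p+q)×d` matrices, there is a bijection between the
orbit space of `{m : f(m) ≠ 0}` under right `GL_d(k)`-multiplication and the product of
the orbit spaces of `{m₁' : f₁(m₁') ≠ 0}` and `{m₂' : f₂(m₂') ≠ 0}` with `GL_d(k)`. -/
theorem orbit_space_product_decomposition
    {k : Type*} [Field k] {d p q : ℕ}
    (hd : 1 ≤ d) (hp : d ≤ p) (hq : d ≤ q)
    (f₁ : Matrix (Fin p) (Fin d) k → k)
    (hf₁ : ∀ (m : Matrix (Fin p) (Fin d) k) (h : Matrix (Fin d) (Fin d) k),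
      IsUnit h → f₁ (m * h) = h.det ^ p * f₁ m)
    (hf₁top : ∀ m, f₁ m ≠ 0 →
      IsUnit (m.submatrix (Fin.castLE hp) (id : Fin d → Fin d)))
    (f₂ : Matrix (Fin q) (Fin d) k → k)
    (hf₂ : ∀ (m : Matrix (Fin q) (Fin d) k) (h : Matrix (Fin d) (Fin d) k),
      IsUnit h → f₂ (m * h) = h.det ^ q * f₂ m)
    (D : Matrix (Fin q) (Fin d) k → Matrix (Fin d) (Fin d) k)
    (hD : ∀ (m : Matrix (Fin q) (Fin d) k) (i j : Fin d),
      D m i j = m ⟨q - d + (i : ℕ), by have := i.isLt; omega⟩ j)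
    (hf₂bot : ∀ m, f₂ m ≠ 0 → IsUnit (D m)) :
    Nonempty
      (Quot (fun a b : {m : Matrix (Fin p ⊕ Fin q) (Fin d) k //
            f₁ (m.submatrix Sum.inl id) * f₂ (m.submatrix Sum.inr id) ≠ 0} =>
          ∃ h : Matrix (Fin d) (Fin d) k, IsUnit h ∧ b.1 = a.1 * h) ≃
        Quot (fun a b : {m : Matrix (Fin p) (Fin d) k // f₁ m ≠ 0} =>
          ∃ h : Matrix (Fin d) (Fin d) k, IsUnit h ∧ b.1 = a.1 * h) ×
        Quot (fun a b : {m : Matrix (Fin q) (Fin d) k // f₂ m ≠ 0} =>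
          ∃ h : Matrix (Fin d) (Fin d) k, IsUnit h ∧ b.1 = a.1 * h) ×
        (Matrix (Fin d) (Fin d) k)ˣ) := by
  refine ⟨orbitProdEquiv f₁ f₂ ?_ ?_ (fun m => m.submatrix (Fin.castLE hp) id) D
    (fun _ _ => rfl) ?_ hf₁top hf₂bot⟩
  · intro m h hh hm
    rw [hf₁ m h hh]
    exact mul_ne_zero (pow_ne_zero _ ((Matrix.isUnit_iff_isUnit_det h).1 hh).ne_zero) hm
  · intro m h hh hm
    rw [hf₂ m h hh]
    exact mul_ne_zero (pow_ne_zero _ ((Matrix.isUnit_iff_isUnit_det h).1 hh).ne_zero) hm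
  · intro m h
    ext
    simp only [hD, Matrix.mul_apply]
end

section
/- Let k be a field, r ≥ 1, and let d₁, …, d_r, d_{r+1} = n be positive natural numbers. For each i = 1, …, r let m_i ∈ Mat_{d_{i+1}×d_i}(k), and let J_i be an injection from {1,…,d_i} into {1,…,n}, determining the d_i×d_i row-submatrix (m_r⋯m_i)_{J_i} of the product m_r m_{r−1}⋯m_i. Let H = GL_{d_r}(k)×⋯×GL_{d_1}(k) act on tuples by (m_r,…,m_1)·h^{-1} := (m_r h_r^{-1}, h_r m_{r−1} h_{r−1}^{-1}, …, h_2 m_1 h_1^{-1}). Assume that for every i the submatrix (m_r⋯m_i)_{J_i} is invertible. Then there is a unique h = (h_r,…,h_1) ∈ H such that the tuple (m̃_r,…,m̃_1) := (m_r,…,m_1)·h^{-1} satisfies (m̃_r⋯m̃_i)_{J_i} = I_{d_i} for every i = 1,…,r; explicitly, h_i = (m_r⋯m_i)_{J_i}. -/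
open Matrix

/-- `chainProd d m i` is the "partial product" `m (r-1) * m (r-2) * ⋯ * m i` of the chain
of matrices `m`, where `m j : Matrix (Fin (d j.succ)) (Fin (d j.castSucc)) k`; for
`i = Fin.last r` it is the identity. -/
def chainProd {k : Type*} [Field k] {r : ℕ} (d : Fin (r + 1) → ℕ)
    (m : ∀ j : Fin r, Matrix (Fin (d j.succ)) (Fin (d j.castSucc)) k) :
    ∀ i : Fin (r + 1), Matrix (Fin (d (Fin.last r))) (Fin (d i)) k :=
  Fin.reverseInduction
    (motive := fun i => Matrix (Fin (d (Fin.last r))) (Fin (d i)) k)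
    1 (fun j acc => acc * m j)

/-- The property that the tuple `h = (h_r, …, h_1) ∈ GL_{d_r} × ⋯ × GL_{d_1}` is made of
invertible matrices and that the translated tuple
`(m_r,…,m_1)·h⁻¹ = (m_r h_r⁻¹, h_r m_{r-1} h_{r-1}⁻¹, …, h_2 m_1 h_1⁻¹)` is normalized:
all the row-submatrices `(m̃_r ⋯ m̃_i)_{J_i}` are identity matrices. -/
def IsNormalizingTuple {k : Type*} [Field k] {r : ℕ} (d : Fin (r + 1) → ℕ)
    (m : ∀ j : Fin r, Matrix (Fin (d j.succ)) (Fin (d j.castSucc)) k)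
    (J : ∀ j : Fin r, Fin (d j.castSucc) ↪ Fin (d (Fin.last r)))
    (h : ∀ j : Fin r, Matrix (Fin (d j.castSucc)) (Fin (d j.castSucc)) k) : Prop :=
  (∀ j, IsUnit (h j)) ∧
  ∀ j : Fin r,
    (chainProd d
      (fun j' : Fin r =>
        Fin.lastCases (motive := fun i => Matrix (Fin (d i)) (Fin (d i)) k) 1 h j'.succ
          * m j' * (h j')⁻¹)
      j.castSucc).submatrix (J j) id = 1

theorem chainProd_last {k : Type*} [Field k] {r : ℕ} (d : Fin (r + 1) → ℕ)
    (m : ∀ j : Fin r, Matrix (Fin (d j.succ)) (Fin (d j.castSucc)) k) :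
    chainProd d m (Fin.last r) = 1 := by
  simp [chainProd]

theorem chainProd_castSucc {k : Type*} [Field k] {r : ℕ} (d : Fin (r + 1) → ℕ)
    (m : ∀ j : Fin r, Matrix (Fin (d j.succ)) (Fin (d j.castSucc)) k) (j : Fin r) :
    chainProd d m j.castSucc = chainProd d m j.succ * m j := by
  simp [chainProd]

/-- Partial products of a chain translated by a tuple `g` of invertible matrices with last
entry `1` telescope. -/
theorem chainProd_translate {k : Type*} [Field k] {r : ℕ} (d : Fin (r + 1) → ℕ)
    (m : ∀ j : Fin r, Matrix (Fin (d j.succ)) (Fin (d j.castSucc)) k)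
    (g : ∀ i : Fin (r + 1), Matrix (Fin (d i)) (Fin (d i)) k)
    (hlast : g (Fin.last r) = 1) (hg : ∀ i, IsUnit (g i)) (i : Fin (r + 1)) :
    chainProd d (fun j => g j.succ * m j * (g j.castSucc)⁻¹) i = chainProd d m i * (g i)⁻¹ := by
  induction i using Fin.reverseInduction with
  | last => rw [chainProd_last, chainProd_last, hlast, inv_one, one_mul]
  | cast j ih =>
    have hu : IsUnit (g j.succ).det := (isUnit_iff_isUnit_det _).1 (hg j.succ)
    rw [chainProd_castSucc, chainProd_castSucc, ih]
    simp only [Matrix.mul_assoc]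
    rw [nonsing_inv_mul_cancel_left _ _ hu]

/-- A tuple is normalizing exactly when it consists of the invertible row-submatrices
`(m_r ⋯ m_i)_{J_i}`. -/
theorem isNormalizingTuple_iff {k : Type*} [Field k] {r : ℕ} (d : Fin (r + 1) → ℕ)
    (m : ∀ j : Fin r, Matrix (Fin (d j.succ)) (Fin (d j.castSucc)) k)
    (J : ∀ j : Fin r, Fin (d j.castSucc) ↪ Fin (d (Fin.last r)))
    (h : ∀ j : Fin r, Matrix (Fin (d j.castSucc)) (Fin (d j.castSucc)) k) :
    IsNormalizingTuple d m J h ↔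
      (∀ j, IsUnit (h j)) ∧ ∀ j, h j = (chainProd d m j.castSucc).submatrix (J j) id := by
  refine and_congr_right fun hu => forall_congr' fun j => ?_
  have key := chainProd_translate d m
    (Fin.lastCases (motive := fun i => Matrix (Fin (d i)) (Fin (d i)) k) 1 h)
    (Fin.lastCases_last ..)
    (Fin.lastCases (by simp) fun j => by simpa using hu j) j.castSucc
  simp only [Fin.lastCases_castSucc] at key
  have hdet : IsUnit (h j).det := (isUnit_iff_isUnit_det _).1 (hu j)
  rw [key, submatrix_mul _ _ _ id _ Function.bijective_id, submatrix_id_id]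
  constructor
  · intro e
    rw [← Matrix.one_mul (h j), ← e, nonsing_inv_mul_cancel_right _ _ hdet]
  · intro e
    rw [← e, mul_nonsing_inv _ hdet]

/-- the special-section lemma, Lemma 8.2 of the paper.  If all the
row-submatrices `(m_r ⋯ m_i)_{J_i}` are invertible, then there is a unique tuple
`h ∈ GL_{d_r} × ⋯ × GL_{d_1}` such that the translate `(m_r,…,m_1)·h⁻¹` satisfies
`(m̃_r ⋯ m̃_i)_{J_i} = I_{d_i}` for all `i`; explicitly, `h_i = (m_r ⋯ m_i)_{J_i}`. -/
theorem unique_special_section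
    {k : Type*} [Field k] {r : ℕ} (hr : 1 ≤ r)
    (d : Fin (r + 1) → ℕ) (hd : ∀ i, 0 < d i)
    (m : ∀ j : Fin r, Matrix (Fin (d j.succ)) (Fin (d j.castSucc)) k)
    (J : ∀ j : Fin r, Fin (d j.castSucc) ↪ Fin (d (Fin.last r)))
    (hinv : ∀ j : Fin r, IsUnit ((chainProd d m j.castSucc).submatrix (J j) id)) :
    (∃! h : ∀ j : Fin r, Matrix (Fin (d j.castSucc)) (Fin (d j.castSucc)) k,
      IsNormalizingTuple d m J h) ∧
    IsNormalizingTuple d m J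
      (fun j => (chainProd d m j.castSucc).submatrix (J j) id) := by
  have hP := (isNormalizingTuple_iff d m J _).2 ⟨hinv, fun _ => rfl⟩
  exact ⟨⟨_, hP, fun h hh => funext ((isNormalizingTuple_iff d m J h).1 hh).2⟩, hP⟩
end

section
/- Let k be a field and let n > d₁ and d > d₁ be natural numbers. Let m₂' ∈ Mat_{(n−d₁)×(d−d₁)}(k), A₂ ∈ Mat_{(n−d₁)×d₁}(k), A₁ ∈ Mat_{(d−d₁)×d₁}(k). Define the n×d block matrix m₂ = [[m₂', A₂],[0, I_{d₁}]] and the d×d₁ matrix m₁ = [A₁; I_{d₁}] (A₁ stacked on the identity). Let J' be an injection from {1,…,d−d₁} into {1,…,n−d₁} such that the J'-row submatrix of m₂' is I_{d−d₁} and the J'-row submatrix of A₂ is the zero matrix. Then, writing (m₂m₁)^{top} for the first n−d₁ rows of the product m₂·m₁: (i) the last d₁ rows of m₂·m₁ form I_{d₁}; (ii) A₁ equals the J'-row submatrix of (m₂m₁)^{top}; (iii) A₂ = (m₂m₁)^{top} − m₂'·A₁. In particular A₁ and A₂ are uniquely determined by m₂' and the product m₂·m₁. -/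
open Matrix

/-- the matrix lemma, Lemma 8.12 of the paper.  Write `n = p + d₁` and
`d = s + d₁` with `p = n - d₁ > 0` and `s = d - d₁ > 0`.  Given
`m₂' ∈ Mat_{p×s}`, `A₂ ∈ Mat_{p×d₁}`, `A₁ ∈ Mat_{s×d₁}`, form the block matrices
`m₂ = [[m₂', A₂],[0, I]]` and `m₁ = [A₁; I]`.  If the `J'`-row submatrix of `m₂'` is the
identity and that of `A₂` is zero, then: (i) the last `d₁` rows of `m₂·m₁` form the
identity; (ii) `A₁` is the `J'`-row submatrix of the first `p` rows of `m₂·m₁`;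
(iii) `A₂ = (m₂·m₁)^top − m₂'·A₁`.  In particular `A₁`, `A₂` are uniquely determined by
`m₂'` and `m₂·m₁`. -/
theorem matrix_lemma_blocks_determined
    {k : Type*} [Field k] {p s d₁ : ℕ} (hp : 0 < p) (hs : 0 < s)
    (m₂' : Matrix (Fin p) (Fin s) k) (A₂ : Matrix (Fin p) (Fin d₁) k)
    (A₁ : Matrix (Fin s) (Fin d₁) k)
    (J' : Fin s ↪ Fin p)
    (h1 : m₂'.submatrix J' id = 1) (h2 : A₂.submatrix J' id = 0) :
    ((fromBlocks m₂' A₂ (0 : Matrix (Fin d₁) (Fin s) k) (1 : Matrix (Fin d₁) (Fin d₁) k) *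
        fromRows A₁ (1 : Matrix (Fin d₁) (Fin d₁) k)).submatrix Sum.inr id = 1) ∧
    (A₁ = ((fromBlocks m₂' A₂ (0 : Matrix (Fin d₁) (Fin s) k)
          (1 : Matrix (Fin d₁) (Fin d₁) k) *
        fromRows A₁ (1 : Matrix (Fin d₁) (Fin d₁) k)).submatrix Sum.inl id).submatrix
        J' id) ∧
    (A₂ = (fromBlocks m₂' A₂ (0 : Matrix (Fin d₁) (Fin s) k)
          (1 : Matrix (Fin d₁) (Fin d₁) k) *
        fromRows A₁ (1 : Matrix (Fin d₁) (Fin d₁) k)).submatrix Sum.inl id - m₂' * A₁) := by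
  rw [fromBlocks_mul_fromRows, Matrix.zero_mul, Matrix.one_mul, Matrix.mul_one, zero_add]
  refine ⟨rfl, ?_, (add_sub_cancel_left (m₂' * A₁) A₂).symm⟩
  change A₁ = m₂'.submatrix J' id * A₁ + A₂.submatrix J' id
  rw [h1, h2, Matrix.one_mul, add_zero]
end

section
/- Let k be a field, r ≥ 2, and let d₁, …, d_r, n be positive natural numbers. Consider tuples (m_r, m_{r−1}, …, m_1) with m_r ∈ Mat_{n×d_r}(k) and m_i ∈ Mat_{d_{i+1}×d_i}(k) for i < r. Let J_r be an injection from {1,…,d_r} into {1,…,n}, and write (m)_{J_r} for the J_r-row submatrix of a matrix m with n rows. Let f₁ be a k-valued function on tuples (a_{r−1}, …, a_1) with a_{r−1} ∈ Mat_{d_r×d_{r−1}}(k) and a_i ∈ Mat_{d_{i+1}×d_i}(k) for i < r−1, and let f₂ : Mat_{n×d_r}(k) → k be such that f₂(m) ≠ 0 implies (m)_{J_r} is invertible. Define F(m_r,…,m_1) := f₁((m_r)_{J_r}·m_{r−1}, m_{r−2}, …, m_1) · f₂(m_r). Then the map Ψ((m'_{r−1},…,m'_1), m'_r) := (m'_r,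 D^{-1}·m'_{r−1}, m'_{r−2}, …, m'_1), where D = (m'_r)_{J_r}, is a bijection from {(t, m'_r) : f₁(t) ≠ 0 and f₂(m'_r) ≠ 0} onto {(m_r,…,m_1) : F(m_r,…,m_1) ≠ 0}, with inverse (m_r,…,m_1) ↦ (((m_r)_{J_r}·m_{r−1}, m_{r−2}, …, m_1), m_r). -/
open Matrix

/-- the Stiefel-level bijection in Case 1 of §8 of the paper, with
`r = t + 2 ≥ 2`.  Tuples `(m_r, m_{r-1}, m_{r-2}, …, m_1)` are encoded as elements of
`Mat_{n×d_r} × (Mat_{d_r×d_{r-1}} × Π_{j<t} Mat_{e(j+1)×e(j)})`, where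
`e : Fin (t+1) → ℕ` records `d_1, …, d_{t+1} = d_{r-1}`.  Given `f₁` on the truncated
tuples `(a_{r-1}, …, a_1)` and `f₂` on `Mat_{n×d_r}` with `f₂(m) ≠ 0` implying the
`J_r`-row submatrix of `m` invertible, set
`F(m_r,…,m_1) = f₁((m_r)_{J_r}·m_{r-1}, m_{r-2}, …, m_1)·f₂(m_r)`.  Then
`Ψ((m'_{r-1},…,m'_1), m'_r) = (m'_r, D⁻¹·m'_{r-1}, m'_{r-2}, …, m'_1)` with
`D = (m'_r)_{J_r}` is a bijection from `{f₁ ≠ 0} × {f₂ ≠ 0}` onto `{F ≠ 0}`, with inverse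
`(m_r,…,m_1) ↦ (((m_r)_{J_r}·m_{r-1}, m_{r-2}, …, m_1), m_r)`. -/
theorem stiefel_bijection_case_one
    {k : Type*} [Field k] {t n dr : ℕ}
    (e : Fin (t + 1) → ℕ) (he : ∀ i, 0 < e i) (hdr : 0 < dr) (hn : 0 < n)
    (f₁ : Matrix (Fin dr) (Fin (e (Fin.last t))) k ×
          (∀ j : Fin t, Matrix (Fin (e j.succ)) (Fin (e j.castSucc)) k) → k)
    (f₂ : Matrix (Fin n) (Fin dr) k → k)
    (Jr : Fin dr ↪ Fin n)
    (hf₂ : ∀ m, f₂ m ≠ 0 → IsUnit (m.submatrix Jr id)) :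
    Set.BijOn
      (fun x : (Matrix (Fin dr) (Fin (e (Fin.last t))) k ×
            (∀ j : Fin t, Matrix (Fin (e j.succ)) (Fin (e j.castSucc)) k)) ×
            Matrix (Fin n) (Fin dr) k =>
        (x.2, ((x.2.submatrix Jr id)⁻¹ * x.1.1, x.1.2)))
      {x | f₁ x.1 ≠ 0 ∧ f₂ x.2 ≠ 0}
      {y : Matrix (Fin n) (Fin dr) k ×
            (Matrix (Fin dr) (Fin (e (Fin.last t))) k ×
            (∀ j : Fin t, Matrix (Fin (e j.succ)) (Fin (e j.castSucc)) k)) |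
        f₁ (y.1.submatrix Jr id * y.2.1, y.2.2) * f₂ y.1 ≠ 0} ∧
    Set.InvOn
      (fun y : Matrix (Fin n) (Fin dr) k ×
            (Matrix (Fin dr) (Fin (e (Fin.last t))) k ×
            (∀ j : Fin t, Matrix (Fin (e j.succ)) (Fin (e j.castSucc)) k)) =>
        ((y.1.submatrix Jr id * y.2.1, y.2.2), y.1))
      (fun x : (Matrix (Fin dr) (Fin (e (Fin.last t))) k ×
            (∀ j : Fin t, Matrix (Fin (e j.succ)) (Fin (e j.castSucc)) k)) ×
            Matrix (Fin n) (Fin dr) k =>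
        (x.2, ((x.2.submatrix Jr id)⁻¹ * x.1.1, x.1.2)))
      {x | f₁ x.1 ≠ 0 ∧ f₂ x.2 ≠ 0}
      {y | f₁ (y.1.submatrix Jr id * y.2.1, y.2.2) * f₂ y.1 ≠ 0} := by
  have hdet : ∀ m, f₂ m ≠ 0 → IsUnit (m.submatrix Jr id).det := fun m hm =>
    (Matrix.isUnit_iff_isUnit_det _).1 (hf₂ m hm)
  refine (fun hinv => ⟨hinv.bijOn ?_ ?_, hinv⟩) ⟨?_, ?_⟩
  · rintro ⟨⟨a, b⟩, m⟩ ⟨-, h₂⟩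
    simp [Matrix.mul_nonsing_inv_cancel_left _ _ (hdet m h₂)]
  · rintro ⟨m, a, b⟩ h
    simp [Matrix.nonsing_inv_mul_cancel_left _ _ (hdet m (right_ne_zero_of_mul h))]
  · rintro ⟨⟨a, b⟩, m⟩ ⟨h₁, h₂⟩
    change f₁ (m.submatrix Jr id * ((m.submatrix Jr id)⁻¹ * a), b) * f₂ m ≠ 0
    rw [Matrix.mul_nonsing_inv_cancel_left _ _ (hdet m h₂)]
    exact mul_ne_zero h₁ h₂
  · rintro ⟨m, a, b⟩ h
    exact mul_ne_zero_iff.1 h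
end

section
/- Let k be a field, r ≥ 3, and let d₁, …, d_r, n be positive natural numbers. Consider tuples (m_r, m_{r−1}, …, m_1) with m_r ∈ Mat_{n×d_r}(k) and m_i ∈ Mat_{d_{i+1}×d_i}(k) for i < r. Let J_{r−1} be an injection from {1,…,d_{r−1}} into {1,…,n}, and write (m)_{J_{r−1}} for the J_{r−1}-row submatrix of a matrix m with n rows. Let f₂ be a k-valued function on pairs (a_r, a_{r−1}) with a_r ∈ Mat_{n×d_r}(k), a_{r−1} ∈ Mat_{d_r×d_{r−1}}(k), such that f₂(a_r, a_{r−1}) ≠ 0 implies (a_r·a_{r−1})_{J_{r−1}} is invertible, and let f₁ be a k-valued function on tuples (b_{r−2}, …, b_1) with b_{r−2} ∈ Mat_{d_{r−1}×d_{r−2}}(k) and b_i ∈ Mat_{d_{i+1}×d_i}(k) for i < r−2. Define F(m_r,…,m_1) := f₁((m_r·m_{r−1})_{J_{r−1}}·m_{r−2}, m_{r−3}, …, m_1) · f₂(m_r, m_{r−1}). Then the map Ψ((m'_{r−2},…,m'_1), (m'_r, m'_{r−1})) := (m'_r, m'_{r−1}, D^{-1}·m'_{r−2}, m'_{r−3},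 …, m'_1), where D = (m'_r·m'_{r−1})_{J_{r−1}}, is a bijection from {(t, s) : f₁(t) ≠ 0 and f₂(s) ≠ 0} onto {(m_r,…,m_1) : F(m_r,…,m_1) ≠ 0}, with inverse (m_r,…,m_1) ↦ (((m_r·m_{r−1})_{J_{r−1}}·m_{r−2}, m_{r−3}, …, m_1), (m_r, m_{r−1})). -/
open Matrix

/-- the Stiefel-level bijection in Case 3 of §8 of the paper, with
`r = t + 3 ≥ 3`.  Tuples `(m_r, m_{r-1}, m_{r-2}, m_{r-3}, …, m_1)` are encoded as
elements of `Mat_{n×d_r} × Mat_{d_r×d_{r-1}} × Mat_{d_{r-1}×d_{r-2}} ×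
Π_{j<t} Mat_{e(j+1)×e(j)}`, where `e : Fin (t+1) → ℕ` records `d_1, …, d_{t+1} = d_{r-2}`.
Given `f₂` on pairs `(a_r, a_{r-1})` with `f₂ ≠ 0` implying the `J_{r-1}`-row submatrix of
`a_r·a_{r-1}` invertible, and `f₁` on the truncated tuples `(b_{r-2}, …, b_1)`, set
`F(m_r,…,m_1) = f₁((m_r·m_{r-1})_{J_{r-1}}·m_{r-2}, m_{r-3}, …, m_1)·f₂(m_r, m_{r-1})`.
Then `Ψ((m'_{r-2},…,m'_1), (m'_r, m'_{r-1})) = (m'_r, m'_{r-1}, D⁻¹·m'_{r-2}, …, m'_1)`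
with `D = (m'_r·m'_{r-1})_{J_{r-1}}` is a bijection from `{f₁ ≠ 0} × {f₂ ≠ 0}` onto
`{F ≠ 0}`, with inverse
`(m_r,…,m_1) ↦ (((m_r·m_{r-1})_{J_{r-1}}·m_{r-2}, m_{r-3}, …, m_1), (m_r, m_{r-1}))`. -/
theorem stiefel_bijection_case_three
    {k : Type*} [Field k] {t n dr drm1 : ℕ}
    (e : Fin (t + 1) → ℕ) (he : ∀ i, 0 < e i)
    (hdr : 0 < dr) (hdrm1 : 0 < drm1) (hn : 0 < n)
    (f₁ : Matrix (Fin drm1) (Fin (e (Fin.last t))) k ×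
          (∀ j : Fin t, Matrix (Fin (e j.succ)) (Fin (e j.castSucc)) k) → k)
    (f₂ : Matrix (Fin n) (Fin dr) k × Matrix (Fin dr) (Fin drm1) k → k)
    (Jrm1 : Fin drm1 ↪ Fin n)
    (hf₂ : ∀ a, f₂ a ≠ 0 → IsUnit ((a.1 * a.2).submatrix Jrm1 id)) :
    Set.BijOn
      (fun x : (Matrix (Fin drm1) (Fin (e (Fin.last t))) k ×
            (∀ j : Fin t, Matrix (Fin (e j.succ)) (Fin (e j.castSucc)) k)) ×
            (Matrix (Fin n) (Fin dr) k × Matrix (Fin dr) (Fin drm1) k) =>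
        (x.2.1, x.2.2, (((x.2.1 * x.2.2).submatrix Jrm1 id)⁻¹ * x.1.1, x.1.2)))
      {x | f₁ x.1 ≠ 0 ∧ f₂ x.2 ≠ 0}
      {y : Matrix (Fin n) (Fin dr) k × Matrix (Fin dr) (Fin drm1) k ×
            (Matrix (Fin drm1) (Fin (e (Fin.last t))) k ×
            (∀ j : Fin t, Matrix (Fin (e j.succ)) (Fin (e j.castSucc)) k)) |
        f₁ ((y.1 * y.2.1).submatrix Jrm1 id * y.2.2.1, y.2.2.2) * f₂ (y.1, y.2.1) ≠ 0} ∧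
    Set.InvOn
      (fun y : Matrix (Fin n) (Fin dr) k × Matrix (Fin dr) (Fin drm1) k ×
            (Matrix (Fin drm1) (Fin (e (Fin.last t))) k ×
            (∀ j : Fin t, Matrix (Fin (e j.succ)) (Fin (e j.castSucc)) k)) =>
        ((((y.1 * y.2.1).submatrix Jrm1 id) * y.2.2.1, y.2.2.2), (y.1, y.2.1)))
      (fun x : (Matrix (Fin drm1) (Fin (e (Fin.last t))) k ×
            (∀ j : Fin t, Matrix (Fin (e j.succ)) (Fin (e j.castSucc)) k)) ×
            (Matrix (Fin n) (Fin dr) k × Matrix (Fin dr) (Fin drm1) k) =>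
        (x.2.1, x.2.2, (((x.2.1 * x.2.2).submatrix Jrm1 id)⁻¹ * x.1.1, x.1.2)))
      {x | f₁ x.1 ≠ 0 ∧ f₂ x.2 ≠ 0}
      {y | f₁ ((y.1 * y.2.1).submatrix Jrm1 id * y.2.2.1, y.2.2.2) * f₂ (y.1, y.2.1) ≠ 0} := by
  rw [and_comm, and_iff_left_of_imp]
  · have hdet (a) (ha : f₂ a ≠ 0) : IsUnit ((a.1 * a.2).submatrix Jrm1 id).det :=
      (isUnit_iff_isUnit_det _).mp (hf₂ a ha)
    constructor
    · rintro ⟨⟨b, c⟩, a⟩ ⟨-, ha⟩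
      simp [mul_nonsing_inv_cancel_left _ b (hdet a ha)]
    · rintro ⟨a, a', b, c⟩ hy
      simp [nonsing_inv_mul_cancel_left _ b (hdet (a, a') (right_ne_zero_of_mul hy))]
  · intro hinv
    refine hinv.bijOn ?_ ?_
    · rintro x ⟨hx₁, hx₂⟩
      have h := hinv.1 ⟨hx₁, hx₂⟩
      have h₁ := congrArg Prod.fst h
      refine mul_ne_zero ?_ hx₂
      exact fun h₀ => hx₁ ((congrArg f₁ h₁).symm.trans h₀)
    · exact fun y hy => ⟨left_ne_zero_of_mul hy, right_ne_zero_of_mul hy⟩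
end
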